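/- arXiv:1809.04917 — 2 statements merged into one kernel-verified Lean document; each statement's English description precedes it below -/
import Mathlib

section
/- (Recursion for the state estimate in terms of successive refinements) Let (Ω, 𝒜, P) be a probability space with a filtration 𝒢_1 ⊆ 𝒢_2 ⊆ ⋯ ⊆ 𝒢_T, let W_0 be a square-integrable random variable, let a ∈ ℝ, and for each t ∈ {1, …, T−1} let U_t be an integrable 𝒢_t-measurable random variable. Define X_1 = W_0 and X_{t+1} = a·X_t + U_t, and set Ŵ_t = E[W_0 | 𝒢_t] and X̂_t = E[X_t | 𝒢_t]. Then for every t ∈ {2, …, T}, almost surely X̂_t = a·X̂_{t−1} + U_{t−1} + a^{t−1}·(Ŵ_t − Ŵ_{t−1}). -/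
open MeasureTheory

/-- Conditional expectation of a multiple of `f` shifted by an `m`-measurable function. -/
theorem condExp_const_mul_add_of_stronglyMeasurable
    {Ω : Type*} {m m0 : MeasurableSpace Ω} {μ : Measure Ω} [IsFiniteMeasure μ] (hm : m ≤ m0)
    {f V : Ω → ℝ} (hf : Integrable f μ) (hV : Integrable V μ) (hVm : StronglyMeasurable[m] V)
    (c : ℝ) :
    μ[fun ω => c * f ω + V ω|m] =ᵐ[μ] fun ω => c * (μ[f|m]) ω + V ω := by
  have h_add := condExp_add (hf.smul c) hV m
  have h_smul := condExp_smul (μ := μ) c f m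
  rw [condExp_of_stronglyMeasurable hm hVm hV] at h_add
  filter_upwards [h_add, h_smul] with ω h₁ h₂
  simp only [Pi.add_apply, h₂, Pi.smul_apply, smul_eq_mul] at h₁
  exact h₁

/-- The state of a scalar linear system is a multiple of its initial state plus a term that is
measurable with respect to the information available to the controller. -/
theorem exists_state_eq_pow_mul_add
    {Ω : Type*} {m0 : MeasurableSpace Ω} (μ : Measure Ω) (T : ℕ) (𝒢 : ℕ → MeasurableSpace Ω)
    (h𝒢_mono : ∀ s t, 1 ≤ s → s ≤ t → t ≤ T → 𝒢 s ≤ 𝒢 t)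
    (W0 : Ω → ℝ) (a : ℝ) (U : ℕ → Ω → ℝ)
    (hU_int : ∀ t, 1 ≤ t → t ≤ T - 1 → Integrable (U t) μ)
    (hU_meas : ∀ t, 1 ≤ t → t ≤ T - 1 → StronglyMeasurable[𝒢 t] (U t))
    (X : ℕ → Ω → ℝ) (hX1 : X 1 = W0)
    (hXrec : ∀ t, 1 ≤ t → t ≤ T - 1 → ∀ ω, X (t + 1) ω = a * X t ω + U t ω)
    (s : ℕ) (hs : s + 1 ≤ T) :
    ∃ V : Ω → ℝ, Integrable V μ ∧ StronglyMeasurable[𝒢 (s + 1)] V ∧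
      X (s + 1) = fun ω => a ^ s * W0 ω + V ω := by
  induction s with
  | zero =>
    exact ⟨fun _ => 0, integrable_zero _ _ _, stronglyMeasurable_const, by simp [hX1]⟩
  | succ s ih =>
    obtain ⟨V, hV, hVm, hX⟩ := ih (by omega)
    refine ⟨fun ω => a * V ω + U (s + 1) ω,
      (hV.const_mul a).add (hU_int _ (by omega) (by omega)),
      ((hVm.const_mul a).add (hU_meas _ (by omega) (by omega))).mono
        (h𝒢_mono _ _ (by omega) (by omega) hs), ?_⟩
    funext ω
    rw [hXrec (s + 1) (by omega) (by omega), hX]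
    ring

/-- **Recursion for the state estimate in terms of successive refinements.**
Let `(Ω, 𝒜, P)` be a probability space with a filtration `𝒢_1 ⊆ ⋯ ⊆ 𝒢_T`, let `W₀` be a
square-integrable random variable, `a ∈ ℝ`, and for each `t ∈ {1, …, T−1}` let `U_t` be
an integrable `𝒢_t`-measurable random variable. Define `X_1 = W₀`,
`X_{t+1} = a·X_t + U_t`, and set `Ŵ_t = E[W₀ | 𝒢_t]`, `X̂_t = E[X_t | 𝒢_t]`. Then for
every `t ∈ {2, …, T}`, almost surely
`X̂_t = a·X̂_{t−1} + U_{t−1} + a^{t−1}·(Ŵ_t − Ŵ_{t−1})`. -/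
theorem state_estimate_recursion
    {Ω : Type*} {m0 : MeasurableSpace Ω} (μ : Measure Ω) [IsProbabilityMeasure μ]
    (T : ℕ) (𝒢 : ℕ → MeasurableSpace Ω)
    (h𝒢_mono : ∀ s t, 1 ≤ s → s ≤ t → t ≤ T → 𝒢 s ≤ 𝒢 t)
    (h𝒢_le : ∀ t, 1 ≤ t → t ≤ T → 𝒢 t ≤ m0)
    (W0 : Ω → ℝ) (hW0 : MemLp W0 2 μ)
    (a : ℝ)
    (U : ℕ → Ω → ℝ)
    (hU_int : ∀ t, 1 ≤ t → t ≤ T - 1 → Integrable (U t) μ)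
    (hU_meas : ∀ t, 1 ≤ t → t ≤ T - 1 → StronglyMeasurable[𝒢 t] (U t))
    (X : ℕ → Ω → ℝ)
    (hX1 : X 1 = W0)
    (hXrec : ∀ t, 1 ≤ t → t ≤ T - 1 → ∀ ω, X (t + 1) ω = a * X t ω + U t ω) :
    ∀ t, 2 ≤ t → t ≤ T →
      μ[X t|𝒢 t] =ᵐ[μ] fun ω =>
        a * (μ[X (t - 1)|𝒢 (t - 1)]) ω + U (t - 1) ω +
          a ^ (t - 1) * ((μ[W0|𝒢 t]) ω - (μ[W0|𝒢 (t - 1)]) ω) := by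
  intro t ht htT
  obtain ⟨s, rfl⟩ : ∃ s, t = s + 1 + 1 := ⟨t - 2, by omega⟩
  simp only [Nat.add_sub_cancel]
  obtain ⟨V, hV, hVm, hX⟩ := exists_state_eq_pow_mul_add μ T 𝒢 h𝒢_mono W0 a U hU_int hU_meas X hX1
    hXrec s (by omega)
  have hX' : X (s + 1 + 1) = fun ω => a ^ (s + 1) * W0 ω + (a * V ω + U (s + 1) ω) := by
    funext ω
    rw [hXrec (s + 1) (by omega) (by omega), hX]
    ring
  have hW : Integrable W0 μ := hW0.integrable one_le_two
  have h_prev := condExp_const_mul_add_of_stronglyMeasurable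
    (h𝒢_le (s + 1) (by omega) (by omega)) hW hV hVm (a ^ s)
  have h_next := condExp_const_mul_add_of_stronglyMeasurable (h𝒢_le (s + 1 + 1) (by omega) htT) hW
    ((hV.const_mul a).add (hU_int (s + 1) (by omega) (by omega)))
    (((hVm.const_mul a).add (hU_meas (s + 1) (by omega) (by omega))).mono
      (h𝒢_mono _ _ (by omega) (by omega) htT)) (a ^ (s + 1))
  rw [hX', hX]
  filter_upwards [h_prev, h_next] with ω h₁ h₂
  refine h₂.trans ?_
  rw [h₁]
  simp only [Pi.add_apply]
  ring
end

section
/- (Cost identity for the certainty-equivalent controller) Let a ∈ ℝ, T ≥ 1, let q_1, …, q_T ≥ 0 and r_1, …, r_{T−1} > 0, and define the Riccati sequence s_{T+1} = 0, s_T = q_T, s_t = q_t + a²·s_{t+1}·r_t/(s_{t+1} + r_t) for t ∈ {1, …, T−1}, together with the gains k_t = a·s_{t+1}/(s_{t+1} + r_t) (so k_T = 0) and g_t = a²·s_{t+1} − s_t + q_t (so g_T = 0). On a probability space, let W_0, W_1, …, W_{T−1} be independent square-integrable zero-mean random variables, and let 𝒢_1 ⊆ ⋯ ⊆ 𝒢_T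 be a filtration with 𝒢_t ⊆ σ(W_0, …, W_{t−1}) for every t. Define X_1 = W_0 and, for t ∈ {1, …, T−1}, X̂_t = E[X_t | 𝒢_t], U_t = −k_t·X̂_t, X_{t+1} = a·X_t + W_t + U_t, and also X̂_T = E[X_T | 𝒢_T]. Then E[q_T·X_T² + Σ_{t=1}^{T−1} (q_t·X_t² + r_t·U_t²)] = Σ_{t=1}^{T} ( s_t·E[W_{t−1}²] + g_t·E[(X_t − X̂_t)²] ). -/
open MeasureTheory

/-- The conditional expectation of a square-integrable variable is an orthogonal projection:
`E[X E[X|m]] = E[E[X|m]²]`. -/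
theorem integral_mul_condExp_self {Ω : Type*} {m m0 : MeasurableSpace Ω} {μ : Measure Ω}
    [IsProbabilityMeasure μ] (hm : m ≤ m0) {X : Ω → ℝ} (hX : MemLp X 2 μ) :
    ∫ ω, X ω * (μ[X|m]) ω ∂μ = ∫ ω, (μ[X|m]) ω ^ 2 ∂μ := by
  have hY : MemLp (μ[X|m]) 2 μ := hX.condExp one_le_two
  have hpull : μ[X * μ[X|m]|m] =ᵐ[μ] μ[X|m] * μ[X|m] :=
    condExp_mul_of_stronglyMeasurable_right stronglyMeasurable_condExp
      (hX.integrable_mul hY) (hX.integrable one_le_two)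
  calc ∫ ω, X ω * (μ[X|m]) ω ∂μ = ∫ ω, (μ[X * μ[X|m]|m]) ω ∂μ := (integral_condExp hm).symm
    _ = ∫ ω, (μ[X|m]) ω ^ 2 ∂μ := integral_congr_ae <| by
      filter_upwards [hpull] with ω hω
      simp [hω, sq]

/-- The mean-square error of a conditional expectation is the loss of second moment. -/
theorem integral_sub_condExp_sq {Ω : Type*} {m m0 : MeasurableSpace Ω} {μ : Measure Ω}
    [IsProbabilityMeasure μ] (hm : m ≤ m0) {X : Ω → ℝ} (hX : MemLp X 2 μ) :
    ∫ ω, (X ω - (μ[X|m]) ω) ^ 2 ∂μ = ∫ ω, X ω ^ 2 ∂μ - ∫ ω, (μ[X|m]) ω ^ 2 ∂μ := by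
  have hY : MemLp (μ[X|m]) 2 μ := hX.condExp one_le_two
  have hXY : Integrable (fun ω => X ω * (μ[X|m]) ω) μ := hX.integrable_mul hY
  have hdiff : Integrable (fun ω => X ω ^ 2 - 2 * (X ω * (μ[X|m]) ω)) μ :=
    hX.integrable_sq.sub (hXY.const_mul 2)
  calc ∫ ω, (X ω - (μ[X|m]) ω) ^ 2 ∂μ
      = ∫ ω, (X ω ^ 2 - 2 * (X ω * (μ[X|m]) ω) + (μ[X|m]) ω ^ 2) ∂μ := by
        congr with ω; ring
    _ = _ := by
        rw [integral_add hdiff hY.integrable_sq,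
          integral_sub hX.integrable_sq (hXY.const_mul 2), integral_const_mul,
          integral_mul_condExp_self hm hX]
        ring

/-- Second moment of `a X + W - c E[X|m]` when `W` is centred and independent of a σ-algebra
with respect to which `X` and `m` are measurable. -/
theorem integral_sq_closed_loop {Ω : Type*} {m n m0 : MeasurableSpace Ω} {μ : Measure Ω}
    [IsProbabilityMeasure μ] (hmn : m ≤ n) (hn : n ≤ m0) (a c : ℝ) {X W : Ω → ℝ}
    (hXn : Measurable[n] X) (hX : MemLp X 2 μ) (hW : MemLp W 2 μ) (hW0 : ∫ ω, W ω ∂μ = 0)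
    (hind : ProbabilityTheory.Indep n (MeasurableSpace.comap W inferInstance) μ) :
    ∫ ω, (a * X ω + W ω + -c * (μ[X|m]) ω) ^ 2 ∂μ =
      a ^ 2 * ∫ ω, X ω ^ 2 ∂μ + (c ^ 2 - 2 * a * c) * ∫ ω, (μ[X|m]) ω ^ 2 ∂μ +
        ∫ ω, W ω ^ 2 ∂μ := by
  have hm : m ≤ m0 := hmn.trans hn
  have hY : MemLp (μ[X|m]) 2 μ := hX.condExp one_le_two
  have hXY : Integrable (fun ω => X ω * (μ[X|m]) ω) μ := hX.integrable_mul hY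
  have hYn : Measurable[n] (μ[X|m]) := stronglyMeasurable_condExp.measurable.mono hmn le_rfl
  have hZn : Measurable[n] (fun ω => a * X ω - c * (μ[X|m]) ω) :=
    (hXn.const_mul a).sub (hYn.const_mul c)
  have hZ : MemLp (fun ω => a * X ω - c * (μ[X|m]) ω) 2 μ :=
    (hX.const_mul a).sub (hY.const_mul c)
  have hZW : Integrable (fun ω => (a * X ω - c * (μ[X|m]) ω) * W ω) μ := hZ.integrable_mul hW
  have hZind : ProbabilityTheory.IndepFun (fun ω => a * X ω - c * (μ[X|m]) ω) W μ :=
    ProbabilityTheory.indep_of_indep_of_le_left hind hZn.comap_le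
  have hcross : ∫ ω, (a * X ω - c * (μ[X|m]) ω) * W ω ∂μ = 0 := by
    rw [hZind.integral_fun_mul_eq_mul_integral hZ.aestronglyMeasurable hW.aestronglyMeasurable,
      hW0, mul_zero]
  have hX2 := hX.integrable_sq.const_mul (a ^ 2)
  have hXY2 := hXY.const_mul (2 * a * c)
  have hY2 := hY.integrable_sq.const_mul (c ^ 2)
  have hsub : Integrable (fun ω => a ^ 2 * X ω ^ 2 - 2 * a * c * (X ω * (μ[X|m]) ω)) μ :=
    hX2.sub hXY2
  have hquad : Integrable (fun ω => a ^ 2 * X ω ^ 2 - 2 * a * c * (X ω * (μ[X|m]) ω) +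
      c ^ 2 * (μ[X|m]) ω ^ 2) μ := hsub.add hY2
  have hquad_cross : Integrable (fun ω => a ^ 2 * X ω ^ 2 - 2 * a * c * (X ω * (μ[X|m]) ω) +
      c ^ 2 * (μ[X|m]) ω ^ 2 + 2 * ((a * X ω - c * (μ[X|m]) ω) * W ω)) μ :=
    hquad.add (hZW.const_mul 2)
  calc ∫ ω, (a * X ω + W ω + -c * (μ[X|m]) ω) ^ 2 ∂μ
      = ∫ ω, (a ^ 2 * X ω ^ 2 - 2 * a * c * (X ω * (μ[X|m]) ω) + c ^ 2 * (μ[X|m]) ω ^ 2 +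
          2 * ((a * X ω - c * (μ[X|m]) ω) * W ω) + W ω ^ 2) ∂μ := by
        congr with ω; ring
    _ = _ := by
        rw [integral_add hquad_cross hW.integrable_sq,
          integral_add hquad (hZW.const_mul 2), integral_add hsub hY2,
          integral_sub hX2 hXY2, integral_const_mul,
          integral_const_mul, integral_const_mul, integral_const_mul, hcross,
          integral_mul_condExp_self hm hX]
        ring

/-- **Cost identity for the certainty-equivalent controller.** For the networked LQG
plant `X_1 = W_0`, `X_{t+1} = a X_t + W_t + U_t` with independent square-integrable
zero-mean disturbances `W_t`, a filtration `𝒢_t ⊆ σ(W_0, …, W_{t−1})`, Riccati quantities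
`s_t, k_t, g_t`, estimates `X̂_t = E[X_t | 𝒢_t]` and control `U_t = −k_t X̂_t`, the LQ
cost satisfies
`E[q_T X_T² + Σ_{t=1}^{T−1}(q_t X_t² + r_t U_t²)]
  = Σ_{t=1}^{T} ( s_t E[W_{t−1}²] + g_t E[(X_t − X̂_t)²] )`. -/
theorem certainty_equivalent_cost_identity
    {Ω : Type*} {m0 : MeasurableSpace Ω} (μ : Measure Ω) [IsProbabilityMeasure μ]
    (a : ℝ) (T : ℕ) (hT : 1 ≤ T)
    (q r s k g : ℕ → ℝ)
    (hq : ∀ t, 1 ≤ t → t ≤ T → 0 ≤ q t)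
    (hr : ∀ t, 1 ≤ t → t ≤ T - 1 → 0 < r t)
    (hsT1 : s (T + 1) = 0) (hsT : s T = q T)
    (hs : ∀ t, 1 ≤ t → t ≤ T - 1 →
      s t = q t + a ^ 2 * s (t + 1) * r t / (s (t + 1) + r t))
    (hk : ∀ t, 1 ≤ t → t ≤ T - 1 → k t = a * s (t + 1) / (s (t + 1) + r t))
    (hkT : k T = 0)
    (hg : ∀ t, 1 ≤ t → t ≤ T → g t = a ^ 2 * s (t + 1) - s t + q t)
    (W : ℕ → Ω → ℝ)
    (hW_meas : ∀ t, Measurable (W t))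
    (hW_mem : ∀ t, t ≤ T - 1 → MemLp (W t) 2 μ)
    (hW_mean : ∀ t, t ≤ T - 1 → ∫ ω, W t ω ∂μ = 0)
    (hW_indep : ProbabilityTheory.iIndepFun W μ)
    (𝒢 : ℕ → MeasurableSpace Ω)
    (h𝒢_mono : ∀ t t', 1 ≤ t → t ≤ t' → t' ≤ T → 𝒢 t ≤ 𝒢 t')
    (h𝒢_le : ∀ t, 1 ≤ t → t ≤ T →
      𝒢 t ≤ ⨆ i ∈ Finset.range t, MeasurableSpace.comap (W i) inferInstance)
    (X Xhat U : ℕ → Ω → ℝ)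
    (hX1 : X 1 = W 0)
    (hXhat : ∀ t, 1 ≤ t → t ≤ T → Xhat t = μ[X t|𝒢 t])
    (hU : ∀ t, 1 ≤ t → t ≤ T - 1 → U t = fun ω => -(k t) * Xhat t ω)
    (hXrec : ∀ t, 1 ≤ t → t ≤ T - 1 →
      X (t + 1) = fun ω => a * X t ω + W t ω + U t ω) :
    ∫ ω, (q T * X T ω ^ 2 +
        ∑ t ∈ Finset.Icc 1 (T - 1), (q t * X t ω ^ 2 + r t * U t ω ^ 2)) ∂μ =
      ∑ t ∈ Finset.Icc 1 T,
        (s t * ∫ ω, W (t - 1) ω ^ 2 ∂μ +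
          g t * ∫ ω, (X t ω - Xhat t ω) ^ 2 ∂μ) := by
  have hs_nonneg : ∀ n t, 1 ≤ t → t + n = T → 0 ≤ s t := by
    intro n
    induction n with
    | zero =>
      intro t ht htT
      obtain rfl : t = T := by omega
      exact hsT ▸ hq t ht le_rfl
    | succ n ih =>
      intro t ht htT
      have h1 := ih (t + 1) (by omega) (by omega)
      have h2 := hr t ht (by omega)
      have h3 := hq t ht (by omega)
      rw [hs t ht (by omega)]
      positivity
  set F : ℕ → MeasurableSpace Ω := fun t =>
    ⨆ i ∈ Finset.range t, MeasurableSpace.comap (W i) inferInstance with hF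
  have hF_le (t : ℕ) : F t ≤ m0 := iSup₂_le fun i _ => (hW_meas i).comap_le
  have hF_succ (t : ℕ) : F t ≤ F (t + 1) :=
    biSup_mono fun i hi => Finset.mem_range.2 ((Finset.mem_range.1 hi).trans t.lt_succ_self)
  have hWF (t : ℕ) : Measurable[F (t + 1)] (W t) :=
    Measurable.of_comap_le <| le_iSup₂ (f := fun i (_ : i ∈ Finset.range (t + 1)) =>
      MeasurableSpace.comap (W i) inferInstance) t (Finset.self_mem_range_succ t)
  have hF_indep (t : ℕ) :
      ProbabilityTheory.Indep (F t) (MeasurableSpace.comap (W t) inferInstance) μ := by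
    have h := ProbabilityTheory.indep_iSup_of_disjoint (fun i => (hW_meas i).comap_le) hW_indep
      (S := ↑(Finset.range t)) (T := {t}) (by simp)
    simpa [hF] using h
  have hX : ∀ t, 1 ≤ t → t ≤ T → Measurable[F t] (X t) ∧ MemLp (X t) 2 μ := by
    intro t ht
    induction t, ht using Nat.le_induction with
    | base => exact fun _ => hX1 ▸ ⟨hWF 0, hW_mem 0 (Nat.zero_le _)⟩
    | succ t ht ih =>
      intro htT
      obtain ⟨hm, hL⟩ := ih (by omega)
      rw [hXrec t ht (by omega), hU t ht (by omega), hXhat t ht (by omega)]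
      have hY : Measurable[F t] (μ[X t|𝒢 t]) :=
        stronglyMeasurable_condExp.measurable.mono (h𝒢_le t ht (by omega)) le_rfl
      refine ⟨Measurable.add (Measurable.add ?_ (hWF t)) ?_, ?_⟩
      · exact (hm.mono (hF_succ t) le_rfl).const_mul a
      · exact (hY.mono (hF_succ t) le_rfl).const_mul _
      · exact ((hL.const_mul a).add (hW_mem t (by omega))).add
          ((hL.condExp one_le_two).const_mul _)
  have hstep : ∀ t, 1 ≤ t → t ≤ T - 1 →
      q t * ∫ ω, X t ω ^ 2 ∂μ + r t * ∫ ω, U t ω ^ 2 ∂μ + s (t + 1) * ∫ ω, X (t + 1) ω ^ 2 ∂μ =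
        s t * ∫ ω, X t ω ^ 2 ∂μ + s (t + 1) * ∫ ω, W t ω ^ 2 ∂μ +
          g t * ∫ ω, (X t ω - Xhat t ω) ^ 2 ∂μ := by
    intro t ht htT
    have hle : 𝒢 t ≤ F t := h𝒢_le t ht (by omega)
    obtain ⟨hm, hL⟩ := hX t ht (by omega)
    have hd : s (t + 1) + r t ≠ 0 :=
      (add_pos_of_nonneg_of_pos (hs_nonneg (T - (t + 1)) (t + 1) (by omega) (by omega))
        (hr t ht htT)).ne'
    rw [hXrec t ht htT, hU t ht htT, hXhat t ht (by omega),
      integral_sub_condExp_sq (hle.trans (hF_le t)) hL,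
      integral_sq_closed_loop hle (hF_le t) a (k t) hm hL (hW_mem t htT) (hW_mean t htT)
        (hF_indep t)]
    simp only [mul_pow, integral_const_mul]
    rw [hg t ht (by omega), hs t ht htT, hk t ht htT]
    field_simp
    ring
  have htel : ∀ n, n ≤ T - 1 →
      ∑ t ∈ Finset.Icc 1 n, (q t * ∫ ω, X t ω ^ 2 ∂μ + r t * ∫ ω, U t ω ^ 2 ∂μ) +
          s (n + 1) * ∫ ω, X (n + 1) ω ^ 2 ∂μ =
        ∑ t ∈ Finset.Icc 1 n, (s t * ∫ ω, W (t - 1) ω ^ 2 ∂μ +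
            g t * ∫ ω, (X t ω - Xhat t ω) ^ 2 ∂μ) +
          s (n + 1) * ∫ ω, W n ω ^ 2 ∂μ := by
    intro n
    induction n with
    | zero => simp [hX1]
    | succ n ih =>
      intro hn
      rw [Finset.sum_Icc_succ_top (by omega), Finset.sum_Icc_succ_top (by omega),
        Nat.add_sub_cancel]
      linarith [ih (by omega), hstep (n + 1) (by omega) hn]
  have hU2 : ∀ t ∈ Finset.Icc 1 (T - 1), Integrable (fun ω => U t ω ^ 2) μ := by
    intro t ht
    obtain ⟨h1, h2⟩ := Finset.mem_Icc.1 ht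
    rw [hU t h1 h2, hXhat t h1 (by omega)]
    exact (((hX t h1 (by omega)).2.condExp one_le_two).const_mul _).integrable_sq
  have hX2 : ∀ t ∈ Finset.Icc 1 (T - 1), Integrable (fun ω => X t ω ^ 2) μ := by
    intro t ht
    obtain ⟨h1, h2⟩ := Finset.mem_Icc.1 ht
    exact (hX t h1 (by omega)).2.integrable_sq
  have hcost : ∀ t ∈ Finset.Icc 1 (T - 1),
      Integrable (fun ω => q t * X t ω ^ 2 + r t * U t ω ^ 2) μ := fun t ht =>
    ((hX2 t ht).const_mul _).add ((hU2 t ht).const_mul _)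
  rw [integral_add ((hX T hT le_rfl).2.integrable_sq.const_mul _) (integrable_finsetSum _ hcost),
    integral_finsetSum _ hcost, integral_const_mul]
  have hsum : ∑ t ∈ Finset.Icc 1 (T - 1), ∫ ω, (q t * X t ω ^ 2 + r t * U t ω ^ 2) ∂μ =
      ∑ t ∈ Finset.Icc 1 (T - 1), (q t * ∫ ω, X t ω ^ 2 ∂μ + r t * ∫ ω, U t ω ^ 2 ∂μ) :=
    Finset.sum_congr rfl fun t ht => by
      rw [integral_add ((hX2 t ht).const_mul _) ((hU2 t ht).const_mul _), integral_const_mul,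
        integral_const_mul]
  have hgT : g T = 0 := by rw [hg T hT le_rfl, hsT1, hsT]; ring
  obtain ⟨n, rfl⟩ : ∃ n, T = n + 1 := ⟨T - 1, by omega⟩
  have h := htel n le_rfl
  rw [hsum, Finset.sum_Icc_succ_top (by omega), hgT, ← hsT]
  simp only [Nat.add_sub_cancel]
  linarith
end
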